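/- Let V be a finite-dimensional real normed vector space, let Λ ⊆ V be a discrete additive subgroup, let C ⊆ V be a closed cone (a closed subset stable under multiplication by nonnegative real scalars), and let ℓ : V → ℝ be a linear functional with ℓ(x) > 0 for every x ∈ C \ {0}. Then there exists μ > 0 such that ℓ(x) ≥ μ for every nonzero x ∈ Λ ∩ C. -/

import Mathlib

/-- A linear functional strictly positive on the nonzero vectors of a closed cone dominates a
positive multiple of the norm on that cone. -/
theorem exists_pos_mul_norm_le_of_isClosed_cone {V : Type*} [NormedAddCommGroup V]
    [NormedSpace ℝ V] [FiniteDimensional ℝ V] {C : Set V} (hC : IsClosed C)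
    (hcone : ∀ x ∈ C, ∀ t : ℝ, 0 ≤ t → t • x ∈ C)
    {ℓ : V →ₗ[ℝ] ℝ} (hℓ : ∀ x ∈ C, x ≠ 0 → 0 < ℓ x) :
    ∃ c : ℝ, 0 < c ∧ ∀ x ∈ C, c * ‖x‖ ≤ ℓ x := by
  have : ProperSpace V := FiniteDimensional.proper ℝ V
  obtain ⟨c, hc, h⟩ := ((isCompact_sphere (0 : V) 1).inter_left hC).exists_forall_le'
    ℓ.continuous_of_finiteDimensional.continuousOn (a := 0)
    fun x hx => hℓ x hx.1 (ne_zero_of_mem_unit_sphere ⟨x, hx.2⟩)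
  refine ⟨c, hc, fun x hx => ?_⟩
  rcases eq_or_ne x 0 with rfl | hx0
  · simp
  have key := h (‖x‖⁻¹ • x)
    ⟨hcone x hx _ (by positivity), by simp [norm_smul, norm_ne_zero_iff.2 hx0]⟩
  rwa [map_smul, smul_eq_mul, inv_mul_eq_div, le_div_iff₀ (norm_pos_iff.2 hx0)] at key

/-- The nonzero elements of a discrete additive subgroup have norm bounded away from zero. -/
theorem AddSubgroup.exists_pos_le_norm_of_discreteTopology {V : Type*} [NormedAddCommGroup V]
    (Λ : AddSubgroup V) [DiscreteTopology Λ] :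
    ∃ δ : ℝ, 0 < δ ∧ ∀ x ∈ Λ, x ≠ 0 → δ ≤ ‖x‖ := by
  obtain ⟨δ, hδ, h⟩ := Metric.isOpen_singleton_iff.1 (isOpen_discrete ({0} : Set Λ))
  refine ⟨δ, hδ, fun x hx hx0 => not_lt.1 fun hlt => hx0 ?_⟩
  exact congrArg Subtype.val (h ⟨x, hx⟩ (by simpa [Subtype.dist_eq] using hlt))

/-- Uniform lower bound from the proof of Lemma 8.2: if `Λ` is a discrete additive subgroup
of a finite-dimensional real normed space, `C` a closed cone, and `ℓ` a linear functional
strictly positive on `C \ {0}`, then `ℓ` is bounded below by some `μ > 0` on the nonzero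
elements of `Λ ∩ C`. -/
theorem stmt_6 {V : Type*} [NormedAddCommGroup V] [NormedSpace ℝ V]
    [FiniteDimensional ℝ V]
    (Λ : AddSubgroup V) (hΛ : DiscreteTopology Λ)
    (C : Set V) (hCclosed : IsClosed C)
    (hCcone : ∀ x ∈ C, ∀ t : ℝ, 0 ≤ t → t • x ∈ C)
    (ℓ : V →ₗ[ℝ] ℝ) (hℓ : ∀ x ∈ C, x ≠ 0 → 0 < ℓ x) :
    ∃ μ : ℝ, 0 < μ ∧ ∀ x ∈ (Λ : Set V) ∩ C, x ≠ 0 → μ ≤ ℓ x := by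
  obtain ⟨c, hc, hcℓ⟩ := exists_pos_mul_norm_le_of_isClosed_cone hCclosed hCcone hℓ
  obtain ⟨δ, hδ, hδΛ⟩ := Λ.exists_pos_le_norm_of_discreteTopology
  exact ⟨c * δ, mul_pos hc hδ, fun x hx hx0 =>
    (mul_le_mul_of_nonneg_left (hδΛ x hx.1 hx0) hc.le).trans (hcℓ x hx.2)⟩
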